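/- arXiv:1801.05015 — 3 statements merged into one kernel-verified Lean document; each statement's English description precedes it below -/
import Mathlib

section
/- Let P̂ be a collection of ≐-equivalence classes of possible formal processes that is closed under sum and negation, and let 𝕀₁ and 𝕀₂ be irreversibility functions on P̂. Then there exists a constant c > 0 such that 𝕀₂(Γ) = c·𝕀₁(Γ) for every Γ ∈ P̂ (an irreversibility function on P̂ is unique up to an overall positive factor). -/
structure EidoSys where
  State : Type
  [decEq : DecidableEq State]
  Eido : Set (Finset State)
  pair : State → State → State
  Sim : Finset State → Finset State → Prop
  Arrow : Finset State → Finset State → Prop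
  pair_inj : ∀ a b a' b', pair a b = pair a' b' → a = a' ∧ b = b'
  eido_nonempty : ∀ A ∈ Eido, A.Nonempty
  singleton_mem : ∀ a : State, ({a} : Finset State) ∈ Eido
  comb_mem : ∀ A B : Finset State, Finset.image₂ pair A B ∈ Eido ↔ A ∈ Eido ∧ B ∈ Eido
  subset_mem : ∀ A B : Finset State, A ∈ Eido → B ⊆ A → B.Nonempty → B ∈ Eido
  sim_refl : ∀ A : Finset State, Sim A A
  sim_symm : ∀ A B : Finset State, Sim A B → Sim B A
  sim_trans : ∀ A B C : Finset State, Sim A B → Sim B C → Sim A C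
  sim_comm : ∀ A B : Finset State, Sim (Finset.image₂ pair A B) (Finset.image₂ pair B A)
  sim_assoc : ∀ A B C : Finset State,
    Sim (Finset.image₂ pair (Finset.image₂ pair A B) C) (Finset.image₂ pair A (Finset.image₂ pair B C))
  sim_congr : ∀ A B C : Finset State, Sim A B → Sim (Finset.image₂ pair A C) (Finset.image₂ pair B C)
  arrow_of_sim : ∀ A B : Finset State, A ∈ Eido → B ∈ Eido → Sim A B → Arrow A B
  arrow_trans : ∀ A B C : Finset State, Arrow A B → Arrow B C → Arrow A C
  arrow_comb : ∀ A B C : Finset State, Arrow A B → Arrow (Finset.image₂ pair A C) (Finset.image₂ pair B C)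
  arrow_cancel : ∀ (A B : Finset State) (s : State),
    Arrow (Finset.image₂ pair A {s}) (Finset.image₂ pair B {s}) → Arrow A B
  arrow_nsubset : ∀ A B : Finset State, A ∈ Eido → B ∈ Eido → B ⊂ A → ¬ Arrow A B
  arrow_subset_single : ∀ (A A' : Finset State) (b : State),
    A ∈ Eido → A' ⊆ A → A'.Nonempty → Arrow A {b} → Arrow A' {b}
  arrow_union : ∀ A₁ A₂ B₁ B₂ : Finset State,
    A₁ ∈ Eido → A₂ ∈ Eido → B₁ ∈ Eido → B₂ ∈ Eido →
    Disjoint A₁ A₂ → Disjoint B₁ B₂ →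
    (∀ a ∈ A₁ ∪ A₂, ∀ b ∈ A₁ ∪ A₂, Arrow {a} {b} ∨ Arrow {b} {a}) →
    (∀ a ∈ B₁ ∪ B₂, ∀ b ∈ B₁ ∪ B₂, Arrow {a} {b} ∨ Arrow {b} {a}) →
    Arrow A₁ B₁ → Arrow A₂ B₂ → Arrow (A₁ ∪ A₂) (B₁ ∪ B₂)

attribute [instance] EidoSys.decEq

namespace EidoSys

variable (S : EidoSys)

/-- Combination of eidostates: the Cartesian product, realized via the pairing map. -/
def comb (A B : Finset S.State) : Finset S.State := Finset.image₂ S.pair A B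

/-- The process (A,B) is possible: A ⇌ B. -/
def Pos (A B : Finset S.State) : Prop := S.Arrow A B ∨ S.Arrow B A

/-- A ↔ B. -/
def Rev (A B : Finset S.State) : Prop := S.Arrow A B ∧ S.Arrow B A

/-- Uniform eidostate. -/
def Uniform (A : Finset S.State) : Prop := A ∈ S.Eido ∧ ∀ a ∈ A, ∀ b ∈ A, S.Pos {a} {b}

/-- Record state: a ↔ a + r for some state a. -/
def IsRecord (r : S.State) : Prop := ∃ a : S.State, S.Rev {a} (S.comb {a} {r})

/-- Information state: an eidostate all of whose elements are record states. -/
def IsInfo (I : Finset S.State) : Prop := I ∈ S.Eido ∧ ∀ r ∈ I, S.IsRecord r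

/-- Bit state: an information state with exactly two elements. -/
def IsBit (I : Finset S.State) : Prop := S.IsInfo I ∧ I.card = 2

/-- Information axiom: there exist a bit state and a possible bit process. -/
def InfoAxiom : Prop := ∃ (r : S.State) (I : Finset S.State), S.IsRecord r ∧ S.IsBit I ∧ S.Pos {r} I

/-- Demon axiom. -/
def DemonAxiom : Prop := ∀ a b : S.State, ∀ J : Finset S.State, S.IsInfo J →
    S.Arrow {a} (S.comb {b} J) →
    (∃ I : Finset S.State, S.IsInfo I ∧ S.Arrow {b} (S.comb {a} I)) ∧
    (∀ I : Finset S.State, S.IsInfo I → S.Arrow {a} (S.comb {b} I) ∨ S.Arrow (S.comb {b} I) {a})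

/-- `copies A n` is the combination of `n+1` copies of `A` (so `copies A 0 = A`). -/
def copies (A : Finset S.State) : ℕ → Finset S.State
  | 0 => A
  | n + 1 => S.comb A (copies A n)

/-- Stability axiom: if nA → nB + J for arbitrarily large n, then A → B. -/
def StabilityAxiom : Prop := ∀ A B J : Finset S.State, A ∈ S.Eido → B ∈ S.Eido → S.IsInfo J →
    (∀ N : ℕ, ∃ n ≥ N, S.Arrow (S.copies A n) (S.comb (S.copies B n) J)) → S.Arrow A B

/-- State-equivalence axiom. -/
def StateEquivAxiom : Prop := ∀ E : Finset S.State, S.Uniform E →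
    ∃ e x y : S.State, S.Arrow {x} {y} ∧ S.Rev (S.comb E {x}) (S.comb {e} {y})

/-- `addCopies A B k` is A + k·B (k copies of B appended to A). -/
def addCopies (A B : Finset S.State) : ℕ → Finset S.State
  | 0 => A
  | k + 1 => S.comb (addCopies A B k) B

/-- A designated set of mechanical states. -/
def MechSet (M : Set S.State) : Prop :=
  (∀ l ∈ M, ∀ m ∈ M, S.pair l m ∈ M) ∧
  (∀ l ∈ M, ∀ m ∈ M, S.Arrow {l} {m} → S.Arrow {m} {l})

/-- Component of content on uniform eidostates. -/
def IsCoCU (Q : Finset S.State → ℝ) : Prop :=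
  (∀ E F : Finset S.State, S.Uniform E → S.Uniform F → Q (S.comb E F) = Q E + Q F) ∧
  (∀ E F : Finset S.State, S.Uniform E → S.Uniform F → S.Pos E F → Q E = Q F)

/-- Entropy function on the uniform eidostates (relative to mechanical states M). -/
def IsEntropyU (M : Set S.State) (Ent : Finset S.State → ℝ) : Prop :=
  (∀ E F : Finset S.State, S.Uniform E → S.Uniform F → Ent (S.comb E F) = Ent E + Ent F) ∧
  (∀ E F : Finset S.State, S.Uniform E → S.Uniform F → S.Pos E F → (S.Arrow E F ↔ Ent E ≤ Ent F)) ∧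
  (∀ m ∈ M, Ent {m} = 0) ∧
  (∀ I : Finset S.State, S.IsInfo I → Ent I = Real.logb 2 (I.card))

end EidoSys

namespace EidoSys

variable (S : EidoSys)

/-- A formal process: an ordered pair of eidostates. -/
abbrev Proc := Finset S.State × Finset S.State

/-- Sum of formal processes. -/
def psum (p q : S.Proc) : S.Proc := (S.comb p.1 q.1, S.comb p.2 q.2)

/-- Negation of a formal process. -/
def pneg (p : S.Proc) : S.Proc := (p.2, p.1)

/-- The equivalence ≐ of formal processes: (A,B) ≐ (C,D) iff there are states x, y with
A + x ∼ C + y and B + x ∼ D + y. -/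
def Peq (p q : S.Proc) : Prop :=
  ∃ x y : S.State, S.Sim (S.comb p.1 {x}) (S.comb q.1 {y}) ∧ S.Sim (S.comb p.2 {x}) (S.comb q.2 {y})

/-- An irreversibility function on a ≐-saturated collection P of possible processes
(representing a collection of ≐-classes): a ≐-invariant, additive real function whose sign
determines the type of each process. -/
def IsIrrevFn (P : Set S.Proc) (I : S.Proc → ℝ) : Prop :=
  (∀ p ∈ P, ∀ q ∈ P, S.Peq p q → I p = I q) ∧
  (∀ p ∈ P, ∀ q ∈ P, I (S.psum p q) = I p + I q) ∧
  (∀ p ∈ P, S.Arrow p.1 p.2 → ¬ S.Arrow p.2 p.1 → 0 < I p) ∧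
  (∀ p ∈ P, S.Arrow p.1 p.2 → S.Arrow p.2 p.1 → I p = 0) ∧
  (∀ p ∈ P, S.Arrow p.2 p.1 → ¬ S.Arrow p.1 p.2 → I p < 0)

end EidoSys

/-- An additive subgroup of the real plane on which both coordinates are positive simultaneously
lies on a line of positive slope through the origin. -/
theorem exists_pos_slope_of_pos_iff (G : AddSubgroup (ℝ × ℝ))
    (hG : ∀ x ∈ G, 0 < x.1 ↔ 0 < x.2) :
    ∃ c : ℝ, 0 < c ∧ ∀ x ∈ G, x.2 = c * x.1 := by
  by_cases hpos : ∃ y ∈ G, 0 < y.1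
  · obtain ⟨y, hy, hy₁⟩ := hpos
    have hy₂ : 0 < y.2 := (hG y hy).1 hy₁
    have key (x : ℝ × ℝ) (hx : x ∈ G) : x.2 / y.2 ≤ x.1 / y.1 := by
      by_contra! hlt
      obtain ⟨r, hr₁, hr₂⟩ := exists_rat_btwn hlt
      have hd : (0 : ℝ) < r.den := by exact_mod_cast r.den_pos
      have hr : (r : ℝ) = r.num / r.den := by exact_mod_cast (Rat.num_div_den r).symm
      rw [hr, div_lt_div_iff₀ hy₁ hd] at hr₁
      rw [hr, div_lt_div_iff₀ hd hy₂] at hr₂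
      have h := (hG _ (G.sub_mem (G.zsmul_mem hx r.den) (G.zsmul_mem hy r.num))).2
        (by simp; linarith)
      simp at h
      linarith
    refine ⟨y.2 / y.1, div_pos hy₂ hy₁, fun x hx => ?_⟩
    have h₁ := key x hx
    have h₂ := key (-x) (G.neg_mem hx)
    simp only [Prod.fst_neg, Prod.snd_neg, neg_div, neg_le_neg_iff] at h₂
    have h := le_antisymm h₁ h₂
    field_simp at h ⊢
    linarith
  · push Not at hpos
    refine ⟨1, one_pos, fun x hx => ?_⟩
    have hx₁ := hpos x hx
    have hn₁ := hpos (-x) (G.neg_mem hx)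
    have hx₂ := mt (hG x hx).2 hx₁.not_gt
    have hn₂ := mt (hG (-x) (G.neg_mem hx)).2 hn₁.not_gt
    simp only [Prod.fst_neg, Prod.snd_neg] at hn₁ hn₂
    linarith

namespace EidoSys

/-- The value of an irreversibility function is positive exactly on the processes that cannot be
run backwards. -/
theorem IsIrrevFn.pos_iff {S : EidoSys} {P : Set S.Proc} {I : S.Proc → ℝ} (h : S.IsIrrevFn P I)
    (hposs : ∀ p ∈ P, S.Pos p.1 p.2) {p : S.Proc} (hp : p ∈ P) :
    0 < I p ↔ ¬ S.Arrow p.2 p.1 := by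
  obtain ⟨-, -, hnat, hrev, hanti⟩ := h
  refine ⟨fun hI hba => ?_, fun hba => hnat p hp ((hposs p hp).resolve_right hba) hba⟩
  by_cases hab : S.Arrow p.1 p.2
  · exact hI.ne' (hrev p hp hab hba)
  · exact hI.not_gt (hanti p hp hba hab)

theorem IsIrrevFn.map_neg {S : EidoSys} {P : Set S.Proc} {I : S.Proc → ℝ} (h : S.IsIrrevFn P I)
    (hposs : ∀ p ∈ P, S.Pos p.1 p.2)
    (hsum : ∀ p ∈ P, ∀ q ∈ P, S.psum p q ∈ P) (hneg : ∀ p ∈ P, S.pneg p ∈ P)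
    {p : S.Proc} (hp : p ∈ P) : I (S.pneg p) = -I p := by
  have hadd := h.2.1 p hp _ (hneg p hp)
  have hadd' := h.2.1 _ (hneg p hp) p hp
  have hq := hsum p hp _ (hneg p hp)
  have hq' := hsum _ (hneg p hp) p hp
  obtain ⟨-, -, hnat, hrev, hanti⟩ := h
  -- `p + (-p)` and `(-p) + p` are negations of each other with the same value.
  by_cases hab : S.Arrow (S.psum p (S.pneg p)).1 (S.psum p (S.pneg p)).2 <;>
    by_cases hba : S.Arrow (S.psum p (S.pneg p)).2 (S.psum p (S.pneg p)).1
  · linarith [hrev _ hq hab hba]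
  · linarith [hnat _ hq hab hba, hanti _ hq' hab hba]
  · linarith [hanti _ hq hba hab, hnat _ hq' hba hab]
  · exact absurd (hposs _ hq) (not_or_intro hab hba)

end EidoSys

/-- An irreversibility function on a collection P̂ of ≐-classes of possible
processes closed under sum and negation is unique up to an overall positive factor. -/
theorem stmt0 (S : EidoSys) (P : Set S.Proc)
    (hposs : ∀ p ∈ P, S.Pos p.1 p.2)
    (hsat : ∀ p ∈ P, ∀ q : S.Proc, S.Peq p q → q ∈ P)
    (hsum : ∀ p ∈ P, ∀ q ∈ P, S.psum p q ∈ P)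
    (hneg : ∀ p ∈ P, S.pneg p ∈ P)
    (I₁ I₂ : S.Proc → ℝ)
    (h₁ : S.IsIrrevFn P I₁) (h₂ : S.IsIrrevFn P I₂) :
    ∃ c : ℝ, 0 < c ∧ ∀ p ∈ P, I₂ p = c * I₁ p := by
  obtain rfl | ⟨p₀, hp₀⟩ := P.eq_empty_or_nonempty
  · exact ⟨1, one_pos, by simp⟩
  have hn₁ {p} (hp : p ∈ P) := h₁.map_neg hposs hsum hneg hp
  have hn₂ {p} (hp : p ∈ P) := h₂.map_neg hposs hsum hneg hp
  let G : AddSubgroup (ℝ × ℝ) :=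
    { carrier := Set.image (fun p => (I₁ p, I₂ p)) P
      add_mem' := by
        rintro _ _ ⟨p, hp, rfl⟩ ⟨q, hq, rfl⟩
        exact ⟨S.psum p q, hsum p hp q hq, Prod.ext (h₁.2.1 p hp q hq) (h₂.2.1 p hp q hq)⟩
      zero_mem' := by
        refine ⟨S.psum p₀ (S.pneg p₀), hsum _ hp₀ _ (hneg _ hp₀), Prod.ext ?_ ?_⟩
        · simp [h₁.2.1 _ hp₀ _ (hneg _ hp₀), hn₁ hp₀]
        · simp [h₂.2.1 _ hp₀ _ (hneg _ hp₀), hn₂ hp₀]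
      neg_mem' := by
        rintro _ ⟨p, hp, rfl⟩
        exact ⟨S.pneg p, hneg p hp, Prod.ext (hn₁ hp) (hn₂ hp)⟩ }
  have hG : ∀ x ∈ G, 0 < x.1 ↔ 0 < x.2 := by
    rintro _ ⟨p, hp, rfl⟩
    exact (h₁.pos_iff hposs hp).trans (h₂.pos_iff hposs hp).symm
  obtain ⟨c, hc, h⟩ := exists_pos_slope_of_pos_iff G hG
  exact ⟨c, hc, fun p hp => h _ ⟨p, hp, rfl⟩⟩
end

section
/- Every bit process is natural irreversible: for every record state r and every bit state I_b, r → I_b but not I_b → r. -/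
namespace EidoSys

/-- Any two record states can be transformed into each other. -/
theorem IsRecord.arrow {S : EidoSys} {r s : S.State} (hr : S.IsRecord r) (hs : S.IsRecord s) :
    S.Arrow {r} {s} := by
  obtain ⟨a, -, har⟩ := hr
  obtain ⟨b, hbs, -⟩ := hs
  have sim_arrow (x y : S.State) (h : S.Sim {x} {y}) : S.Arrow {x} {y} :=
    S.arrow_of_sim _ _ (S.singleton_mem x) (S.singleton_mem y) h
  have comm (x y : S.State) : S.Sim {S.pair x y} {S.pair y x} := by
    simpa using S.sim_comm {x} {y}
  have assoc (x y z : S.State) :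
      S.Sim {S.pair (S.pair x y) z} {S.pair x (S.pair y z)} := by
    simpa using S.sim_assoc {x} {y} {z}
  have congr (x y z : S.State) (h : S.Sim {x} {y}) : S.Sim {S.pair x z} {S.pair y z} := by
    simpa using S.sim_congr {x} {y} {z} h
  have absorb : S.Arrow {S.pair (S.pair a r) b} {S.pair a b} := by
    simpa [comb] using S.arrow_comb _ _ {b} har
  have emit : S.Arrow {S.pair b a} {S.pair (S.pair b s) a} := by
    simpa [comb] using S.arrow_comb _ _ {a} hbs
  have start : S.Sim {S.pair r (S.pair a b)} {S.pair (S.pair a r) b} :=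
    S.sim_trans _ _ _ (S.sim_symm _ _ (assoc r a b)) (congr _ _ b (comm r a))
  have finish : S.Sim {S.pair (S.pair b s) a} {S.pair s (S.pair a b)} :=
    S.sim_trans _ _ _ (comm _ _)
      (S.sim_trans _ _ _ (S.sim_symm _ _ (assoc a b s)) (comm _ _))
  have total : S.Arrow {S.pair r (S.pair a b)} {S.pair s (S.pair a b)} :=
    S.arrow_trans _ _ _ (sim_arrow _ _ start) <| S.arrow_trans _ _ _ absorb <|
      S.arrow_trans _ _ _ (sim_arrow _ _ (comm a b)) <|
        S.arrow_trans _ _ _ emit (sim_arrow _ _ finish)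
  exact S.arrow_cancel {r} {s} (S.pair a b) (by simpa using total)

/-- Any two bit states can be transformed into each other. -/
theorem IsBit.arrow {S : EidoSys} {I J : Finset S.State} (hI : S.IsBit I) (hJ : S.IsBit J) :
    S.Arrow I J := by
  obtain ⟨⟨-, hI⟩, cI⟩ := hI
  obtain ⟨⟨-, hJ⟩, cJ⟩ := hJ
  obtain ⟨x, y, hxy, rfl⟩ := Finset.card_eq_two.mp cI
  obtain ⟨u, v, huv, rfl⟩ := Finset.card_eq_two.mp cJ
  exact S.arrow_union {x} {y} {u} {v}
    (S.singleton_mem x) (S.singleton_mem y) (S.singleton_mem u) (S.singleton_mem v)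
    (Finset.disjoint_singleton.mpr hxy) (Finset.disjoint_singleton.mpr huv)
    (fun a ha b hb => Or.inl ((hI a ha).arrow (hI b hb)))
    (fun a ha b hb => Or.inl ((hJ a ha).arrow (hJ b hb)))
    ((hI x (by simp)).arrow (hJ u (by simp))) ((hI y (by simp)).arrow (hJ v (by simp)))

/-- A bit state cannot be transformed into a record state. -/
theorem IsBit.not_arrow {S : EidoSys} {I : Finset S.State} {r : S.State} (hI : S.IsBit I)
    (hr : S.IsRecord r) : ¬ S.Arrow I {r} := by
  obtain ⟨⟨hE, hI⟩, cI⟩ := hI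
  obtain ⟨x, y, hxy, rfl⟩ := Finset.card_eq_two.mp cI
  intro h
  refine S.arrow_nsubset _ {x} hE (S.singleton_mem x) ?_
    (S.arrow_trans _ _ _ h (hr.arrow (hI x (by simp))))
  exact (Finset.ssubset_iff_of_subset (by simp)).mpr ⟨y, by simp, by simpa using hxy.symm⟩

end EidoSys

/-- Every bit process is natural irreversible: for every record state r and every
bit state I_b, r → I_b but not I_b → r. -/
theorem stmt2 (S : EidoSys) (hinfo : S.InfoAxiom) :
    ∀ r : S.State, S.IsRecord r → ∀ Ib : Finset S.State, S.IsBit Ib →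
      S.Arrow {r} Ib ∧ ¬ S.Arrow Ib {r} := by
  obtain ⟨r₀, I₀, hr₀, hI₀, hpos⟩ := hinfo
  intro r hr Ib hIb
  have hbit : S.Arrow {r₀} I₀ := hpos.resolve_right (hI₀.not_arrow hr₀)
  exact ⟨S.arrow_trans _ _ _ (hr.arrow hr₀) (S.arrow_trans _ _ _ hbit (hI₀.arrow hIb)),
    hIb.not_arrow hr⟩
end

section
/- The Hartley–Shannon entropy is the unique quasi-entropy on information states: if 𝕊 is a quasi-entropy on the collection ℐ of information states normalized so that 𝕊(I_b) = 1 for a bit state I_b, then 𝕊(I) = log₂ |I| for every information state I. -/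
namespace EidoSys

variable (S : EidoSys)

/-- A quasi-entropy on the collection ℐ of information states. -/
def IsQuasiEntropyInfo (Ent : Finset S.State → ℝ) : Prop :=
  (∀ I J : Finset S.State, S.IsInfo I → S.IsInfo J → Ent (S.comb I J) = Ent I + Ent J) ∧
  (∀ I J : Finset S.State, S.IsInfo I → S.IsInfo J → S.Arrow I J → ¬ S.Arrow J I →
      Ent I < Ent J) ∧
  (∀ I J : Finset S.State, S.IsInfo I → S.IsInfo J → S.Rev I J → Ent I = Ent J)

end EidoSys

namespace EidoSys

variable {S : EidoSys}

lemma rev_refl {A : Finset S.State} (hA : A ∈ S.Eido) : S.Rev A A :=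
  ⟨S.arrow_of_sim _ _ hA hA (S.sim_refl A), S.arrow_of_sim _ _ hA hA (S.sim_refl A)⟩

lemma Rev.symm {A B : Finset S.State} (h : S.Rev A B) : S.Rev B A := ⟨h.2, h.1⟩

lemma Rev.trans {A B C : Finset S.State} (h : S.Rev A B) (h' : S.Rev B C) : S.Rev A C :=
  ⟨S.arrow_trans _ _ _ h.1 h'.1, S.arrow_trans _ _ _ h'.2 h.2⟩

lemma Rev.comb_right {A B : Finset S.State} (h : S.Rev A B) (C : Finset S.State) :
    S.Rev (S.comb A C) (S.comb B C) :=
  ⟨S.arrow_comb _ _ _ h.1, S.arrow_comb _ _ _ h.2⟩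

lemma comb_mem_eido {A B : Finset S.State} (hA : A ∈ S.Eido) (hB : B ∈ S.Eido) :
    S.comb A B ∈ S.Eido :=
  (S.comb_mem A B).2 ⟨hA, hB⟩

lemma rev_comb_comm {A B : Finset S.State} (hA : A ∈ S.Eido) (hB : B ∈ S.Eido) :
    S.Rev (S.comb A B) (S.comb B A) :=
  ⟨S.arrow_of_sim _ _ (comb_mem_eido hA hB) (comb_mem_eido hB hA) (S.sim_comm A B),
    S.arrow_of_sim _ _ (comb_mem_eido hB hA) (comb_mem_eido hA hB) (S.sim_comm B A)⟩

lemma rev_comb_assoc {A B C : Finset S.State} (hA : A ∈ S.Eido) (hB : B ∈ S.Eido)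
    (hC : C ∈ S.Eido) : S.Rev (S.comb (S.comb A B) C) (S.comb A (S.comb B C)) := by
  have h₁ := comb_mem_eido (comb_mem_eido hA hB) hC
  have h₂ := comb_mem_eido hA (comb_mem_eido hB hC)
  exact ⟨S.arrow_of_sim _ _ h₁ h₂ (S.sim_assoc A B C),
    S.arrow_of_sim _ _ h₂ h₁ (S.sim_symm _ _ (S.sim_assoc A B C))⟩

lemma Rev.comb_left {A B C : Finset S.State} (h : S.Rev A B) (hA : A ∈ S.Eido)
    (hB : B ∈ S.Eido) (hC : C ∈ S.Eido) : S.Rev (S.comb C A) (S.comb C B) :=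
  ((rev_comb_comm hC hA).trans (h.comb_right C)).trans (rev_comb_comm hB hC)

/-- Appending a record state to any eidostate is reversible. -/
lemma IsRecord.rev_comb {r : S.State} (hr : S.IsRecord r) {A : Finset S.State}
    (hA : A ∈ S.Eido) : S.Rev A (S.comb A {r}) := by
  obtain ⟨a, ha⟩ := hr
  have ma := S.singleton_mem a
  have mr := S.singleton_mem r
  have h : S.Rev (S.comb A {a}) (S.comb (S.comb A {r}) {a}) :=
    ((ha.comb_left ma (comb_mem_eido ma mr) hA).trans
      ((rev_comb_comm ma mr).comb_left (comb_mem_eido ma mr) (comb_mem_eido mr ma) hA)).trans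
      (rev_comb_assoc hA mr ma).symm
  exact ⟨S.arrow_cancel _ _ a h.1, S.arrow_cancel _ _ a h.2⟩

lemma IsRecord.rev {r s : S.State} (hr : S.IsRecord r) (hs : S.IsRecord s) :
    S.Rev {r} {s} :=
  ((hs.rev_comb (S.singleton_mem r)).trans
    (rev_comb_comm (S.singleton_mem r) (S.singleton_mem s))).trans
    (hr.rev_comb (S.singleton_mem s)).symm

lemma IsRecord.pair {r s : S.State} (hr : S.IsRecord r) (hs : S.IsRecord s) :
    S.IsRecord (S.pair r s) := by
  refine ⟨r, ?_⟩
  have mr := S.singleton_mem r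
  have ms := S.singleton_mem s
  have h := ((hr.rev_comb mr).trans (hs.rev_comb (comb_mem_eido mr mr))).trans
    (rev_comb_assoc mr mr ms)
  have e : S.comb {r} {s} = {S.pair r s} := Finset.image₂_singleton
  rwa [e] at h

lemma IsInfo.comb {I J : Finset S.State} (hI : S.IsInfo I) (hJ : S.IsInfo J) :
    S.IsInfo (S.comb I J) := by
  refine ⟨comb_mem_eido hI.1 hJ.1, fun x hx => ?_⟩
  obtain ⟨r, hr, s, hs, rfl⟩ := Finset.mem_image₂.1 hx
  exact (hI.2 r hr).pair (hJ.2 s hs)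

lemma card_comb (A B : Finset S.State) : (S.comb A B).card = A.card * B.card :=
  Finset.card_image₂ (fun _ _ _ _ h => S.pair_inj _ _ _ _ h) A B

lemma IsInfo.subset {I J : Finset S.State} (hI : S.IsInfo I) (hJI : J ⊆ I)
    (hJ : J.Nonempty) : S.IsInfo J :=
  ⟨S.subset_mem I J hI.1 hJI hJ, fun r hr => hI.2 r (hJI hr)⟩

lemma isInfo_singleton {r : S.State} (hr : S.IsRecord r) : S.IsInfo {r} :=
  ⟨S.singleton_mem r, fun s hs => by rwa [Finset.mem_singleton.1 hs]⟩

lemma IsInfo.card_pos {I : Finset S.State} (hI : S.IsInfo I) : 0 < I.card :=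
  (S.eido_nonempty I hI.1).card_pos

lemma IsInfo.pos_of_mem {I : Finset S.State} (hI : S.IsInfo I) :
    ∀ a ∈ I, ∀ b ∈ I, S.Arrow {a} {b} ∨ S.Arrow {b} {a} :=
  fun a ha b hb => Or.inl ((hI.2 a ha).rev (hI.2 b hb)).1

/-- An arrow between information states extends by one new element on each side. -/
lemma IsInfo.arrow_of_erase {I J : Finset S.State} (hI : S.IsInfo I) (hJ : S.IsInfo J)
    {x y : S.State} (hx : x ∈ I) (hy : y ∈ J) (hI' : (I.erase x).Nonempty)
    (hJ' : (J.erase y).Nonempty) (h : S.Arrow (I.erase x) (J.erase y)) : S.Arrow I J := by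
  have eI : I.erase x ∪ {x} = I := by
    rw [Finset.union_comm, ← Finset.insert_eq, Finset.insert_erase hx]
  have eJ : J.erase y ∪ {y} = J := by
    rw [Finset.union_comm, ← Finset.insert_eq, Finset.insert_erase hy]
  have key := S.arrow_union (I.erase x) {x} (J.erase y) {y}
    (hI.subset (Finset.erase_subset _ _) hI').1 (S.singleton_mem x)
    (hJ.subset (Finset.erase_subset _ _) hJ').1 (S.singleton_mem y)
    (by simp) (by simp) (by rw [eI]; exact hI.pos_of_mem) (by rw [eJ]; exact hJ.pos_of_mem)
    h ((hI.2 x hx).rev (hJ.2 y hy)).1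
  rwa [eI, eJ] at key

lemma IsInfo.arrow_of_card_eq {I J : Finset S.State} (hI : S.IsInfo I) (hJ : S.IsInfo J)
    (h : I.card = J.card) : S.Arrow I J := by
  obtain ⟨n, hn⟩ : ∃ n, I.card = n + 1 := ⟨I.card - 1, by have := hI.card_pos; omega⟩
  induction n generalizing I J with
  | zero =>
    obtain ⟨r, rfl⟩ := Finset.card_eq_one.1 hn
    obtain ⟨s, rfl⟩ := Finset.card_eq_one.1 (h ▸ hn)
    exact ((hI.2 r (by simp)).rev (hJ.2 s (by simp))).1
  | succ n ih =>
    obtain ⟨x, hx⟩ := S.eido_nonempty I hI.1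
    obtain ⟨y, hy⟩ := S.eido_nonempty J hJ.1
    have cI := Finset.card_erase_of_mem hx
    have cJ := Finset.card_erase_of_mem hy
    have nI : (I.erase x).Nonempty := Finset.card_pos.1 (by omega)
    have nJ : (J.erase y).Nonempty := Finset.card_pos.1 (by omega)
    exact hI.arrow_of_erase hJ hx hy nI nJ
      (ih (hI.subset (Finset.erase_subset _ _) nI) (hJ.subset (Finset.erase_subset _ _) nJ)
        (by omega) (by omega))

lemma IsInfo.rev_of_card_eq {I J : Finset S.State} (hI : S.IsInfo I) (hJ : S.IsInfo J)
    (h : I.card = J.card) : S.Rev I J :=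
  ⟨hI.arrow_of_card_eq hJ h, hJ.arrow_of_card_eq hI h.symm⟩

lemma IsInfo.not_arrow_of_card_lt {I J : Finset S.State} (hI : S.IsInfo I) (hJ : S.IsInfo J)
    (h : J.card < I.card) : ¬ S.Arrow I J := by
  obtain ⟨K, hKI, hK⟩ := Finset.exists_subset_card_eq h.le
  have iK : S.IsInfo K := hI.subset hKI (Finset.card_pos.1 (hK ▸ hJ.card_pos))
  have hne : K ≠ I := by
    rintro rfl
    omega
  exact fun hIJ => S.arrow_nsubset I K hI.1 iK.1 (hKI.ssubset_of_ne hne)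
    (S.arrow_trans _ _ _ hIJ (hJ.arrow_of_card_eq iK hK.symm))

lemma IsInfo.arrow_of_card_succ (hinfo : S.InfoAxiom) {I J : Finset S.State}
    (hI : S.IsInfo I) (hJ : S.IsInfo J) (h : J.card = I.card + 1) : S.Arrow I J := by
  obtain ⟨n, hn⟩ : ∃ n, I.card = n + 1 := ⟨I.card - 1, by have := hI.card_pos; omega⟩
  induction n generalizing I J with
  | zero =>
    obtain ⟨r, B, hr, hB, hrB⟩ := hinfo
    have ir := isInfo_singleton hr
    have hB2 := hB.2
    have arr : S.Arrow {r} B := hrB.resolve_right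
      (hB.1.not_arrow_of_card_lt ir (by rw [Finset.card_singleton]; omega))
    exact S.arrow_trans _ _ _ (hI.arrow_of_card_eq ir (by rw [Finset.card_singleton]; omega))
      (S.arrow_trans _ _ _ arr (hB.1.arrow_of_card_eq hJ (by omega)))
  | succ n ih =>
    obtain ⟨x, hx⟩ := S.eido_nonempty I hI.1
    obtain ⟨y, hy⟩ := S.eido_nonempty J hJ.1
    have cI := Finset.card_erase_of_mem hx
    have cJ := Finset.card_erase_of_mem hy
    have nI : (I.erase x).Nonempty := Finset.card_pos.1 (by omega)
    have nJ : (J.erase y).Nonempty := Finset.card_pos.1 (by omega)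
    exact hI.arrow_of_erase hJ hx hy nI nJ
      (ih (hI.subset (Finset.erase_subset _ _) nI) (hJ.subset (Finset.erase_subset _ _) nJ)
        (by omega) (by omega))

lemma IsBit.exists_isInfo_card {B : Finset S.State} (hB : S.IsBit B) {n : ℕ} (hn : 0 < n) :
    ∃ I : Finset S.State, S.IsInfo I ∧ I.card = n := by
  have pow : ∀ k : ℕ, ∃ I : Finset S.State, S.IsInfo I ∧ I.card = 2 ^ (k + 1) := by
    intro k
    induction k with
    | zero => exact ⟨B, hB.1, by simpa using hB.2⟩
    | succ k ih =>
      obtain ⟨I, hI, cI⟩ := ih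
      exact ⟨S.comb I B, hI.comb hB.1, by rw [card_comb, cI, hB.2, pow_succ _ (k + 1)]⟩
  obtain ⟨I, hI, cI⟩ := pow n
  obtain ⟨K, hKI, hK⟩ := Finset.exists_subset_card_eq (s := I) (n := n)
    (by rw [cI]; exact (n.lt_succ_self.trans Nat.lt_two_pow_self).le)
  exact ⟨K, hI.subset hKI (Finset.card_pos.1 (hK ▸ hn)), hK⟩

end EidoSys

/-- A monotone completely additive arithmetic function with `f 2 = 1` is the binary logarithm. -/
lemma eq_logb_two_of_mul_of_mono (f : ℕ → ℝ)
    (hmul : ∀ m n : ℕ, 0 < m → 0 < n → f (m * n) = f m + f n)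
    (hmono : ∀ m n : ℕ, 0 < m → m ≤ n → f m ≤ f n) (h2 : f 2 = 1) {n : ℕ} (hn : 0 < n) :
    f n = Real.logb 2 n := by
  have hone : f 1 = 0 := by simpa using hmul 1 1 one_pos one_pos
  have hpow : ∀ m : ℕ, 0 < m → ∀ k : ℕ, f (m ^ k) = k * f m := by
    intro m hm k
    induction k with
    | zero => simpa using hone
    | succ k ih =>
      rw [pow_succ, hmul _ _ (pow_pos hm k) hm, ih]
      push_cast
      ring
  have bound : ∀ k : ℕ, k * |f n - Real.logb 2 n| ≤ 1 := by
    intro k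
    have hk : 0 < n ^ k := pow_pos hn k
    have lo : 2 ^ Nat.log 2 (n ^ k) ≤ n ^ k := Nat.pow_log_le_self 2 hk.ne'
    have hi : n ^ k ≤ 2 ^ (Nat.log 2 (n ^ k) + 1) :=
      (Nat.lt_pow_succ_log_self one_lt_two _).le
    generalize Nat.log 2 (n ^ k) = j at lo hi
    have f_lo := hmono _ _ (by positivity) lo
    have f_hi := hmono _ _ hk hi
    rw [hpow 2 two_pos, hpow n hn, h2] at f_lo f_hi
    have l_lo : (j : ℝ) ≤ k * Real.logb 2 n := by
      rw [← Real.logb_pow, Real.le_logb_iff_rpow_le one_lt_two (by exact_mod_cast hk),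
        Real.rpow_natCast]
      exact_mod_cast lo
    have l_hi : k * Real.logb 2 n ≤ (j + 1 : ℕ) := by
      rw [← Real.logb_pow, Real.logb_le_iff_le_rpow one_lt_two (by exact_mod_cast hk),
        Real.rpow_natCast]
      exact_mod_cast hi
    push_cast at f_hi l_hi
    rw [← abs_of_nonneg (Nat.cast_nonneg (α := ℝ) k), ← abs_mul, abs_le]
    constructor <;> linarith
  by_contra hne
  have hd : 0 < |f n - Real.logb 2 n| := abs_pos.2 (sub_ne_zero.2 hne)
  obtain ⟨k, hk⟩ := exists_lt_nsmul hd 1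
  rw [nsmul_eq_mul] at hk
  exact absurd (bound k) hk.not_ge

/-- The Hartley–Shannon entropy is the unique quasi-entropy on information
states: if 𝕊 is a quasi-entropy on ℐ normalized so that 𝕊(I_b) = 1 for a bit state I_b,
then 𝕊(I) = log₂|I| for every information state I. -/
theorem stmt4 (S : EidoSys) (hinfo : S.InfoAxiom)
    (Ent : Finset S.State → ℝ) (hq : S.IsQuasiEntropyInfo Ent)
    (hnorm : ∃ Ib : Finset S.State, S.IsBit Ib ∧ Ent Ib = 1) :
    ∀ I : Finset S.State, S.IsInfo I → Ent I = Real.logb 2 (I.card) := by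
  obtain ⟨hadd, hlt, heq⟩ := hq
  obtain ⟨B, hB, hB1⟩ := hnorm
  choose! W hW hWcard using fun n hn => hB.exists_isInfo_card (n := n) hn
  have hEnt : ∀ I : Finset S.State, S.IsInfo I → Ent I = Ent (W I.card) := fun I hI =>
    heq _ _ hI (hW _ hI.card_pos) (hI.rev_of_card_eq (hW _ hI.card_pos) (hWcard _ hI.card_pos).symm)
  intro I hI
  rw [hEnt I hI]
  refine eq_logb_two_of_mul_of_mono (fun n => Ent (W n)) ?_ ?_ ?_ hI.card_pos
  · intro m n hm hn
    have h := hEnt _ ((hW m hm).comb (hW n hn))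
    rw [EidoSys.card_comb, hWcard m hm, hWcard n hn, hadd _ _ (hW m hm) (hW n hn)] at h
    exact h.symm
  · intro m n hm hmn
    induction n, hmn using Nat.le_induction with
    | base => exact le_rfl
    | succ n hmn ih =>
      have hn : 0 < n := hm.trans_le hmn
      have i₁ := hW n hn
      have i₂ := hW (n + 1) n.succ_pos
      have c₁ := hWcard n hn
      have c₂ := hWcard (n + 1) n.succ_pos
      exact ih.trans (hlt _ _ i₁ i₂ (i₁.arrow_of_card_succ hinfo i₂ (by omega))
        (i₂.not_arrow_of_card_lt i₁ (by omega))).le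
  · have h := hEnt B hB.1
    rw [hB.2, hB1] at h
    exact h.symm
end
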